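/- For any abelian group A, there is an exact sequence 0 → Φ(A) → Γ(A) → A ⊗ A → Λ²(A) → 0, where Γ(A) → A ⊗ A sends γ(a) to a ⊗ a, A ⊗ A → Λ²(A) is the canonical projection, and Φ(A) = ⊕_{n≥1} Φ_n(A) maps in via a ↦ 2ⁿ γ(a) on the n-th summand. -/

import Mathlib

def crossEff {A B : Type*} [AddCommGroup A] [AddCommGroup B] (f : A → B) (a b : A) : B :=
  f (a + b) - f a - f b

def IsQuadraticMap {A B : Type*} [AddCommGroup A] [AddCommGroup B] (f : A → B) : Prop :=
  (∀ a₁ a₂ b : A, crossEff f (a₁ + a₂) b = crossEff f a₁ b + crossEff f a₂ b) ∧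
  (∀ a b₁ b₂ : A, crossEff f a (b₁ + b₂) = crossEff f a b₁ + crossEff f a b₂)

/-- A homogeneous quadratic map: quadratic and `f(-a) = f(a)`. -/
def IsHomogQuadraticMap {A B : Type*} [AddCommGroup A] [AddCommGroup B] (f : A → B) : Prop :=
  IsQuadraticMap f ∧ ∀ a : A, f (-a) = f a

/-- `t_n(A) = {a ∈ A | 2ⁿ a = 0}` (so `t_0 = 0`). -/
def tSub (A : Type*) [AddCommGroup A] (n : ℕ) : AddSubgroup A where
  carrier := {a | (2 ^ n : ℕ) • a = 0}
  zero_mem' := by simp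
  add_mem' := by
    intro a b ha hb
    simp only [Set.mem_setOf_eq] at ha hb ⊢
    rw [smul_add, ha, hb, add_zero]
  neg_mem' := by intro a ha; simp only [Set.mem_setOf_eq] at ha ⊢; rw [smul_neg, ha, neg_zero]

/-- The image of `t_{n+1}(A) ⊕ t_{n-1}(A) → t_n(A)`, `(a,b) ↦ 2a + b`. -/
def phiRel (A : Type*) [AddCommGroup A] (n : ℕ) : AddSubgroup (tSub A n) :=
  AddSubgroup.closure
    {x | ∃ a ∈ tSub A (n + 1), ∃ b ∈ tSub A (n - 1), (x : A) = 2 • a + b}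

/-- `Φ_n(A) = coker(t_{n+1}(A) ⊕ t_{n-1}(A) → t_n(A))`. -/
def PhiN (A : Type*) [AddCommGroup A] (n : ℕ) := tSub A n ⧸ phiRel A n

instance (A : Type*) [AddCommGroup A] (n : ℕ) : AddCommGroup (PhiN A n) :=
  inferInstanceAs (AddCommGroup (tSub A n ⧸ phiRel A n))

open TensorProduct DirectSum

/-- The alternating relations in `A ⊗ A`. -/
def altRel (A : Type*) [AddCommGroup A] : Submodule ℤ (A ⊗[ℤ] A) :=
  Submodule.span ℤ {x | ∃ a : A, a ⊗ₜ[ℤ] a = x}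

/-- The second exterior power `Λ²(A)`. -/
def LambdaSq (A : Type*) [AddCommGroup A] := (A ⊗[ℤ] A) ⧸ altRel A

noncomputable instance (A : Type*) [AddCommGroup A] : AddCommGroup (LambdaSq A) :=
  inferInstanceAs (AddCommGroup ((A ⊗[ℤ] A) ⧸ altRel A))

/-- The canonical projection `A ⊗ A → Λ²(A)` as a group homomorphism. -/
noncomputable def lamProj (A : Type*) [AddCommGroup A] : (A ⊗[ℤ] A) →+ LambdaSq A :=
  (altRel A).mkQ.toAddMonoidHom


namespace PhiGam

section quad
variable {A B : Type*} [AddCommGroup A] [AddCommGroup B]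

def polarHom (f : A → B) (hf : IsHomogQuadraticMap f) : A →+ A →+ B :=
  AddMonoidHom.mk' (fun a => AddMonoidHom.mk' (crossEff f a) (hf.1.2 a))
    (fun a b => by ext c; exact hf.1.1 a b c)

variable {f : A → B} (hf : IsHomogQuadraticMap f)

theorem polarHom_apply (a b : A) : polarHom f hf a b = f (a + b) - f a - f b := rfl

theorem map_add' (a b : A) : f (a + b) = f a + f b + polarHom f hf a b := by
  rw [polarHom_apply]; abel

theorem polar_symm (a b : A) : polarHom f hf a b = polarHom f hf b a := by
  rw [polarHom_apply, polarHom_apply, add_comm b a]; abel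

include hf in
theorem map_zero' : f 0 = 0 := by
  have := polarHom_apply hf 0 0
  simpa using this

theorem polar_self (a : A) : polarHom f hf a a = 2 • f a := by
  have h1 : polarHom f hf a (-a) = - (2 • f a) := by
    rw [polarHom_apply, hf.2, add_neg_cancel, map_zero' hf]; abel
  rw [map_neg] at h1
  exact neg_injective h1

theorem polar_nsmul_left (n : ℕ) (a b : A) :
    polarHom f hf (n • a) b = n • polarHom f hf a b := by
  rw [map_nsmul]; rfl

theorem polar_zsmul_left (n : ℤ) (a b : A) :
    polarHom f hf (n • a) b = n • polarHom f hf a b := by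
  rw [map_zsmul]; rfl

include hf in
theorem map_nsmul' (n : ℕ) (a : A) : f (n • a) = (n ^ 2) • f a := by
  induction n with
  | zero => simp [map_zero' hf]
  | succ n ih =>
    rw [add_smul, one_smul, map_add' hf, ih, polar_nsmul_left,
      polar_self]
    module

include hf in
theorem map_zsmul' (n : ℤ) (a : A) : f (n • a) = (n ^ 2) • f a := by
  obtain ⟨k, rfl | rfl⟩ := n.eq_nat_or_neg
  · rw [natCast_zsmul, map_nsmul' hf, ← natCast_zsmul]; simp
  · rw [neg_smul, hf.2, natCast_zsmul, map_nsmul' hf, ← natCast_zsmul]; simp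

include hf in
/-- if `d a = 0` then `2 d f(a) = 0` -/
theorem two_smul_eq_zero (d : ℕ) (a : A) (h : d • a = 0) : (2 * d) • f a = 0 := by
  have := polar_self hf a
  rw [mul_comm, mul_smul, ← this, ← polar_nsmul_left, h]
  simp

/-- span of generators -/
theorem mem_gens {κ : Type*} [Fintype κ] [LinearOrder κ] (e : κ → A) (s : Finset κ) (c : κ → ℤ) :
    f (∑ i ∈ s, c i • e i) ∈ Submodule.span ℤ (Set.range
      (Sum.elim (fun i => f (e i))
        (fun p : {p : κ × κ // p.1 < p.2} => polarHom f hf (e p.1.1) (e p.1.2)))) := by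
  classical
  induction s using Finset.induction_on with
  | empty => simp [map_zero' hf]
  | insert i s hi ih =>
    rw [Finset.sum_insert hi, map_add' hf, map_zsmul' hf]
    refine add_mem (add_mem (Submodule.smul_mem _ _ (Submodule.subset_span ⟨Sum.inl i, rfl⟩)) ih) ?_
    rw [map_sum]
    refine Submodule.sum_mem _ fun j hj => ?_
    rw [map_zsmul, polar_zsmul_left]
    refine Submodule.smul_mem _ _ (Submodule.smul_mem _ _ ?_)
    rcases lt_trichotomy i j with h | h | h
    · exact Submodule.subset_span ⟨Sum.inr ⟨(i, j), h⟩, rfl⟩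
    · subst h; exact absurd hj hi
    · rw [polar_symm]
      exact Submodule.subset_span ⟨Sum.inr ⟨(j, i), h⟩, rfl⟩

end quad

theorem vanish_left {A M : Type*} [AddCommGroup A] [AddCommGroup M] {κ : Type*} [Fintype κ]
    (c : κ → ℤ) (m : κ → A) (n : κ → M) (h : ∑ k, c k • (m k ⊗ₜ[ℤ] n k) = 0) :
    ∃ Q : Submodule ℤ A, Q.FG ∧ ∃ m' : κ → Q, (∀ k, (m' k : A) = m k) ∧
      ∑ k, c k • (m' k ⊗ₜ[ℤ] n k) = 0 := by
  let P : Submodule ℤ A := Submodule.span ℤ (Set.range m)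
  have hP : P.FG := Submodule.fg_span (Set.finite_range m)
  let t : P ⊗[ℤ] M := ∑ k, c k • ((⟨m k, Submodule.subset_span ⟨k, rfl⟩⟩ : P) ⊗ₜ[ℤ] n k)
  have ht : LinearMap.rTensor M P.subtype t = 0 := by
    simp only [t, map_sum, map_zsmul, LinearMap.rTensor_tmul]
    exact h
  obtain ⟨Q, hle, hQ, h0⟩ := TensorProduct.eq_zero_of_fg_of_subtype_eq_zero hP ht
  refine ⟨Q, hQ, fun k => ⟨m k, hle (Submodule.subset_span ⟨k, rfl⟩)⟩, fun k => rfl, ?_⟩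
  rw [← h0]
  simp only [t, map_sum, map_zsmul, LinearMap.rTensor_tmul]
  rfl

theorem vanish_both {A : Type*} [AddCommGroup A] {κ : Type*} [Fintype κ]
    (c : κ → ℤ) (m : κ → A) (h : ∑ k, c k • (m k ⊗ₜ[ℤ] m k) = 0) :
    ∃ Q : Submodule ℤ A, Q.FG ∧ ∃ m' : κ → Q, (∀ k, (m' k : A) = m k) ∧
      ∑ k, c k • (m' k ⊗ₜ[ℤ] m' k) = 0 := by
  obtain ⟨Q1, h1, m1, e1, z1⟩ := vanish_left c m m h
  have z1' := congrArg (TensorProduct.comm ℤ Q1 A) z1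
  simp only [map_sum, map_zsmul, TensorProduct.comm_tmul, map_zero] at z1'
  obtain ⟨Q2, h2, m2, e2, z2⟩ := vanish_left c m m1 z1'
  have z3 := congrArg (TensorProduct.map (Submodule.inclusion (le_sup_right : Q2 ≤ Q1 ⊔ Q2))
    (Submodule.inclusion (le_sup_left : Q1 ≤ Q1 ⊔ Q2))) z2
  simp only [map_sum, map_zsmul, TensorProduct.map_tmul, map_zero] at z3
  refine ⟨Q1 ⊔ Q2, h1.sup h2, fun k => Submodule.inclusion (le_sup_left : Q1 ≤ Q1 ⊔ Q2) (m1 k),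
    fun k => by simp [e1], ?_⟩
  rw [← z3]
  refine Finset.sum_congr rfl fun k _ => ?_
  congr 2
  ext
  simp [e1, e2]

theorem fg_structure (A : Type*) [AddCommGroup A] [AddGroup.FG A] :
    ∃ (κ : Type) (_ : Fintype κ) (_ : LinearOrder κ) (d : κ → ℕ) (e : κ → A)
      (π : ∀ i, A →+ ZMod (d i)),
      (∀ a : A, ∃ c : κ → ℤ, a = ∑ i, c i • e i) ∧ (∀ i, d i • e i = 0) ∧
      (∀ i, π i (e i) = 1) ∧ (∀ i j, i ≠ j → π i (e j) = 0) := by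
  classical
  obtain ⟨n, ι, _, p, hp, k, ⟨F⟩⟩ := AddCommGroup.equiv_free_prod_directSum_zmod A
  let κ := Fin n ⊕ ι
  let _ : LinearOrder κ := LinearOrder.lift' (Fintype.equivFin κ) (Fintype.equivFin κ).injective
  let d : κ → ℕ := Sum.elim (fun _ => 0) (fun i => p i ^ k i)
  let e' : κ → (Fin n →₀ ℤ) × ⨁ i : ι, ZMod (p i ^ k i) :=
    Sum.elim (fun i => (Finsupp.single i 1, 0))
      (fun i => (0, DirectSum.of (fun i => ZMod (p i ^ k i)) i 1))
  let π' : ∀ i : κ, ((Fin n →₀ ℤ) × ⨁ i : ι, ZMod (p i ^ k i)) →+ ZMod (d i) := fun i =>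
    match i with
    | Sum.inl i => (Finsupp.applyAddHom i : (Fin n →₀ ℤ) →+ ℤ).comp (AddMonoidHom.fst _ _)
    | Sum.inr i => (DFinsupp.evalAddMonoidHom i :
        (⨁ i : ι, ZMod (p i ^ k i)) →+ ZMod (p i ^ k i)).comp (AddMonoidHom.snd _ _)
  refine ⟨κ, inferInstance, inferInstance, d, fun i => F.symm (e' i),
    fun i => (π' i).comp F.toAddMonoidHom, ?_, ?_, ?_, ?_⟩
  · intro a
    obtain ⟨b, rfl⟩ := F.symm.surjective a
    let c : κ → ℤ := Sum.elim (fun i => b.1 i) (fun i => ((b.2 i).cast : ℤ))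
    refine ⟨c, ?_⟩
    have : b = ∑ i, c i • e' i := by
      rw [Fintype.sum_sum_type]
      ext i
      · simp [c, e', Prod.fst_sum, Finsupp.single_apply]
      · simp only [c, e', Sum.elim_inl, Sum.elim_inr, Prod.snd_add, Prod.snd_sum, Prod.smul_snd, 
          smul_zero, Finset.sum_const_zero, zero_add]
        have : b.2 = ∑ x, ((b.2 x).cast : ℤ) • DirectSum.of (fun i => ZMod (p i ^ k i)) x 1 := by
          conv_lhs => rw [← DirectSum.sum_univ_of b.2]
          refine Finset.sum_congr rfl fun x _ => ?_
          rw [← map_zsmul]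
          congr 1
          simp
        rw [← this]
    conv_lhs => rw [this]
    simp [map_sum]
  · rintro (i | i)
    · simp [d]
    · simp only [d, e', Sum.elim_inr]
      rw [← map_nsmul, Prod.smul_mk, ← map_nsmul]
      simp
  · intro i
    change π' i (F (F.symm (e' i))) = 1
    rw [F.apply_symm_apply]
    rcases i with i | i
    · change (Finsupp.single i (1 : ℤ)) i = 1
      simp
    · exact DirectSum.of_eq_same i _
  · intro i j hij
    change π' i (F (F.symm (e' j))) = 0
    rw [F.apply_symm_apply]
    rcases i with i | i <;> rcases j with j | j
    · have : j ≠ i := fun h => hij (by rw [h])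
      change (Finsupp.single j (1 : ℤ)) i = 0
      simp [Finsupp.single_apply, this]
    · rfl
    · rfl
    · have : j ≠ i := fun h => hij (by rw [h])
      exact DirectSum.of_eq_of_ne _ _ _ this.symm

section core
variable {A G : Type*} [AddCommGroup A] [AddCommGroup G] {γ : A → G} (hγ : IsHomogQuadraticMap γ)

include hγ in
theorem smul_gamma_mem (S : AddSubgroup G)
    (hS : ∀ (n : ℕ) (a : A), (2 ^ (n + 1) : ℕ) • a = 0 → (2 ^ (n + 1) : ℕ) • γ a ∈ S)
    (d : ℕ) (a : A) (h : d • a = 0) : d • γ a ∈ S := by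
  rcases Nat.eq_zero_or_pos d with rfl | hd
  · simp
  obtain ⟨n, m, hm, rfl⟩ := Nat.exists_eq_two_pow_mul_odd hd.ne'
  have h2 := two_smul_eq_zero hγ _ a h
  obtain ⟨r, rfl⟩ := hm
  have key : (2 ^ n * (2 * r + 1)) • γ a = (2 ^ n) • γ ((2 * r + 1) • a) := by
    rw [map_nsmul' hγ, ← mul_smul]
    have : 2 ^ n * (2 * r + 1) ^ 2 = 2 ^ n * (2 * r + 1) + r * (2 * (2 ^ n * (2 * r + 1))) := by ring
    rw [this, add_smul, mul_smul r, h2, smul_zero, add_zero]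
  rw [key]
  rcases n with _ | n
  · have : (2 * r + 1) • a = 0 := by simpa using h
    rw [this, map_zero' hγ]; simp
  · apply hS
    rw [← mul_smul, h]

theorem tmul_quad (Q : Type*) [AddCommGroup Q] : 
    IsHomogQuadraticMap (fun a : Q => a ⊗ₜ[ℤ] a) := by
  refine ⟨⟨fun a b c => ?_, fun a b c => ?_⟩, fun a => ?_⟩
  · simp only [crossEff, TensorProduct.add_tmul, TensorProduct.tmul_add]; abel
  · simp only [crossEff, TensorProduct.add_tmul, TensorProduct.tmul_add]; abel
  · simp [TensorProduct.neg_tmul, TensorProduct.tmul_neg]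

def theta {Q : Type*} [AddCommGroup Q] {d1 d2 : ℕ} (p : Q →+ ZMod d1) (q : Q →+ ZMod d2) :
    Q ⊗[ℤ] Q →ₗ[ℤ] ZMod (Nat.gcd d1 d2) :=
  TensorProduct.lift ((LinearMap.mul ℤ (ZMod (Nat.gcd d1 d2))).compl₁₂
    ((ZMod.castHom (Nat.gcd_dvd_left d1 d2) (ZMod (Nat.gcd d1 d2))).toAddMonoidHom.comp
      p).toIntLinearMap
    ((ZMod.castHom (Nat.gcd_dvd_right d1 d2) (ZMod (Nat.gcd d1 d2))).toAddMonoidHom.comp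
      q).toIntLinearMap)

theorem theta_tmul {Q : Type*} [AddCommGroup Q] {d1 d2 : ℕ} (p : Q →+ ZMod d1) (q : Q →+ ZMod d2)
    (a b : Q) : theta p q (a ⊗ₜ b) =
      ZMod.castHom (Nat.gcd_dvd_left d1 d2) (ZMod (Nat.gcd d1 d2)) (p a) *
      ZMod.castHom (Nat.gcd_dvd_right d1 d2) (ZMod (Nat.gcd d1 d2)) (q b) := rfl

include hγ in
theorem core (S : AddSubgroup G)
    (hS : ∀ (n : ℕ) (a : A), (2 ^ (n + 1) : ℕ) • a = 0 → (2 ^ (n + 1) : ℕ) • γ a ∈ S)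
    {ν : Type*} [Fintype ν] (c : ν → ℤ) (m : ν → A) (h : ∑ k, c k • (m k ⊗ₜ[ℤ] m k) = 0) :
    ∑ k, c k • γ (m k) ∈ S := by
  classical
  obtain ⟨Q, hQ, m', em, z⟩ := vanish_both c m h
  have : AddGroup.FG Q := by
    rw [← Module.Finite.iff_addGroup_fg]
    exact Module.Finite.of_fg hQ
  obtain ⟨κ, _, _, d, e, π, hspan, hde, hπ1, hπ0⟩ := fg_structure Q
  let F : Q → G × (Q ⊗[ℤ] Q) := fun a => (γ a, a ⊗ₜ[ℤ] a)
  have ht := tmul_quad Q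
  have hF : IsHomogQuadraticMap F := by
    refine ⟨⟨fun a b x => ?_, fun a b x => ?_⟩, fun a => ?_⟩
    · exact Prod.ext (hγ.1.1 a b x) (ht.1.1 a b x)
    · exact Prod.ext (hγ.1.2 a b x) (ht.1.2 a b x)
    · exact Prod.ext (hγ.2 a) (ht.2 a)
  have hy : ∑ k, c k • F (m' k) ∈ Submodule.span ℤ (Set.range
      (Sum.elim (fun i => F (e i))
        (fun p : {p : κ × κ // p.1 < p.2} => polarHom F hF (e p.1.1) (e p.1.2)))) := by
    refine Submodule.sum_mem _ fun k _ => Submodule.smul_mem _ _ ?_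
    obtain ⟨x, hx⟩ := hspan (m' k)
    rw [hx]
    exact mem_gens hF e Finset.univ x
  obtain ⟨w, hw⟩ := (Submodule.mem_span_range_iff_exists_fun ℤ).1 hy
  rw [Fintype.sum_sum_type] at hw
  simp only [Sum.elim_inl, Sum.elim_inr] at hw
  have hw1 := congrArg Prod.fst hw
  have hw2 := congrArg Prod.snd hw
  have pol : ∀ i j, polarHom F hF (e i) (e j) =
      (polarHom γ hγ (e i) (e j), e i ⊗ₜ[ℤ] e j + e j ⊗ₜ[ℤ] e i) := by
    intro i j
    refine Prod.ext rfl ?_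
    change (e i + e j) ⊗ₜ[ℤ] (e i + e j) - e i ⊗ₜ[ℤ] e i - e j ⊗ₜ[ℤ] e j = _
    simp only [TensorProduct.add_tmul, TensorProduct.tmul_add]; abel
  simp only [pol, F, Prod.fst_add, Prod.fst_sum, Prod.smul_fst, em] at hw1
  simp only [pol, F, Prod.snd_add, Prod.snd_sum, Prod.smul_snd, z] at hw2
  rw [← hw1]
  have hπ : ∀ i j, π i (e j) = if i = j then 1 else 0 := by
    intro i j
    split_ifs with h
    · subst h; exact hπ1 i
    · exact hπ0 i j h
  have hth : ∀ i j k l, theta (π i) (π j) (e k ⊗ₜ e l) = if i = k ∧ j = l then 1 else 0 := by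
    intro i j k l
    rw [theta_tmul, hπ, hπ]
    by_cases h1 : i = k <;> by_cases h2 : j = l <;> simp [h1, h2, -ZMod.castHom_apply]
  have hdvd : ∀ i j, i ≤ j → theta (π i) (π j) 
    (∑ i, w (Sum.inl i) • e i ⊗ₜ[ℤ] e i + ∑ p : {p : κ × κ // p.1 < p.2}, 
      w (Sum.inr p) • (e p.1.1 ⊗ₜ[ℤ] e p.1.2 + e p.1.2 ⊗ₜ[ℤ] e p.1.1)) = 0 := by
    intro i j _
    rw [hw2, map_zero]
  simp only [map_add, map_sum, map_zsmul, hth] at hdvd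
  refine add_mem (sum_mem fun i _ => ?_) (sum_mem fun p _ => ?_)
  · have h1 := hdvd i i le_rfl
    rw [Finset.sum_eq_single i, Finset.sum_eq_zero] at h1
    · simp only [and_self, if_true, add_zero, zsmul_one] at h1
      rw [ZMod.intCast_zmod_eq_zero_iff_dvd, Nat.gcd_self] at h1
      obtain ⟨q, hq⟩ := h1
      rw [hq, mul_comm, mul_smul, natCast_zsmul]
      refine zsmul_mem (smul_gamma_mem hγ S hS _ _ ?_) _
      have := congrArg (Subtype.val) (hde i)
      simpa using this
    · rintro ⟨⟨k, l⟩, hkl⟩ _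
      have hkl : k < l := hkl
      rw [if_neg, if_neg]
      · simp
      · rintro ⟨rfl, h⟩; exact hkl.ne h.symm
      · rintro ⟨rfl, h⟩; exact hkl.ne h
    · intro k _ hk
      simp [hk.symm]
    · simp
  · obtain ⟨⟨i, j⟩, hij⟩ := p
    have hij' : i < j := hij
    have h1 := hdvd i j hij'.le
    rw [Finset.sum_eq_zero, zero_add, Finset.sum_eq_single ⟨(i, j), hij⟩] at h1
    · have hji : ¬ (i = j ∧ j = i) := fun h => hij'.ne h.1
      simp only [and_self, if_true, if_neg hji, add_zero, zsmul_one] at h1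
      rw [ZMod.intCast_zmod_eq_zero_iff_dvd] at h1
      have hi : d i • polarHom γ hγ (e i) (e j) = 0 := by
        have := congrArg (Subtype.val) (hde i)
        rw [← polar_nsmul_left]
        have h3 : d i • (e i : A) = 0 := by simpa using this
        rw [h3]; simp
      have hj : d j • polarHom γ hγ (e i) (e j) = 0 := by
        have := congrArg (Subtype.val) (hde j)
        rw [← map_nsmul]
        have h3 : d j • (e j : A) = 0 := by simpa using this
        rw [h3]; simp
      have hg : Nat.gcd (d i) (d j) • polarHom γ hγ (e i) (e j) = 0 :=
        addOrderOf_dvd_iff_nsmul_eq_zero.1 (Nat.dvd_gcd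
          (addOrderOf_dvd_iff_nsmul_eq_zero.2 hi) (addOrderOf_dvd_iff_nsmul_eq_zero.2 hj))
      obtain ⟨q, hq⟩ := h1
      rw [hq, mul_comm, mul_smul, natCast_zsmul, hg, smul_zero]
      exact zero_mem _
    · rintro ⟨⟨k, l⟩, hkl⟩ _ hne
      have hkl : k < l := hkl
      rw [if_neg, if_neg]
      · simp
      · rintro ⟨rfl, rfl⟩; exact lt_asymm hkl hij'
      · rintro ⟨rfl, rfl⟩; exact hne rfl
    · simp
    · intro k _ 
      rw [if_neg, smul_zero]
      rintro ⟨rfl, h⟩; exact hij'.ne h.symm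

end core

section char

abbrev QZ := AddCircle (1 : ℚ)

theorem extend_char {M A : Type*} [AddCommGroup M] [AddCommGroup A] (f : M →+ A) (g : M →+ QZ)
    (h : ∀ x, f x = 0 → g x = 0) : ∃ χ : A →+ QZ, ∀ x, χ (f x) = g x := by
  let f' : M ⧸ f.ker →+ A := QuotientAddGroup.kerLift f
  let g' : M ⧸ f.ker →+ QZ := QuotientAddGroup.lift f.ker g (fun x hx => h x hx)
  obtain ⟨χ, hχ⟩ := (Module.Baer.of_divisible QZ).extension_property_addMonoidHom f'
    (QuotientAddGroup.kerLift_injective f) g'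
  refine ⟨χ, fun x => ?_⟩
  exact DFunLike.congr_fun hχ (x : M ⧸ f.ker)

theorem qz_lift (N : ℕ) (hN : 0 < N) (x : QZ) (h : N • x = 0) :
    ∃ k : ℤ, x = (((k : ℚ) / N : ℚ) : QZ) := by
  induction x using QuotientAddGroup.induction_on with
  | H r =>
    have h' : ((N • r : ℚ) : QZ) = 0 := h
    rw [AddCircle.coe_eq_zero_iff] at h'
    obtain ⟨k, hk⟩ := h'
    refine ⟨k, ?_⟩
    have : (r : ℚ) = k / N := by
      have : (N : ℚ) ≠ 0 := by positivity
      field_simp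
      simp at hk
      linarith
    rw [this]

theorem qz_int (k : ℤ) : ((k : ℚ) : QZ) = 0 := by
  rw [AddCircle.coe_eq_zero_iff]; exact ⟨k, by simp⟩

theorem qz_eq_iff (N : ℕ) (hN : 0 < N) (k l : ℤ) :
    (((k : ℚ) / N : ℚ) : QZ) = (((l : ℚ) / N : ℚ) : QZ) ↔ (N : ℤ) ∣ k - l := by
  have hN' : (N : ℚ) ≠ 0 := by positivity
  rw [← sub_eq_zero, ← AddCircle.coe_sub, AddCircle.coe_eq_zero_iff]
  constructor
  · rintro ⟨q, hq⟩
    refine ⟨q, ?_⟩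
    field_simp at hq
    simp at hq
    have : ((k - l : ℤ) : ℚ) = ((N * q : ℤ) : ℚ) := by push_cast; linarith
    exact_mod_cast this
  · rintro ⟨q, hq⟩
    refine ⟨q, ?_⟩
    have : ((k - l : ℤ) : ℚ) = ((N * q : ℤ) : ℚ) := by rw [hq]
    push_cast at this
    field_simp
    simp
    linarith

/-- The quadratic form `x ↦ χ(x)² / 2^(n+2)` with `χ` of order `2^(n+1)`. -/
theorem exists_quad {A : Type*} [AddCommGroup A] (n : ℕ) (χ : A →+ QZ)
    (hχ : ∀ a, (2 ^ (n + 1) : ℕ) • χ a = 0) :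
    ∃ q : A → QZ, IsHomogQuadraticMap q ∧ ∀ (a : A) (x : ℤ),
      χ a = (((x : ℚ) / (2 ^ (n + 1) : ℕ) : ℚ) : QZ) →
      q a = ((((x ^ 2 : ℤ) : ℚ) / (2 ^ (n + 2) : ℕ) : ℚ) : QZ) := by
  have hex : ∀ a, ∃ k : ℤ, χ a = (((k : ℚ) / (2 ^ (n + 1) : ℕ) : ℚ) : QZ) :=
    fun a => qz_lift _ (by positivity) _ (hχ a)
  choose k hk using hex
  let q : A → QZ := fun a => (((((k a) ^ 2 : ℤ) : ℚ) / (2 ^ (n + 2) : ℕ) : ℚ) : QZ)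
  have hq : ∀ (a : A) (x : ℤ), χ a = (((x : ℚ) / (2 ^ (n + 1) : ℕ) : ℚ) : QZ) →
      q a = ((((x ^ 2 : ℤ) : ℚ) / (2 ^ (n + 2) : ℕ) : ℚ) : QZ) := by
    intro a x hx
    rw [hk a, qz_eq_iff _ (by positivity)] at hx
    refine (qz_eq_iff _ (by positivity) _ _).2 ?_
    obtain ⟨r, hr⟩ := hx
    have : k a = x + (2 ^ (n + 1) : ℕ) * r := by linarith
    rw [this]
    refine ⟨x * r + 2 ^ n * r ^ 2, ?_⟩
    push_cast
    ring
  have hadd : ∀ a b (x y : ℤ), χ a = (((x : ℚ) / (2 ^ (n + 1) : ℕ) : ℚ) : QZ) →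
      χ b = (((y : ℚ) / (2 ^ (n + 1) : ℕ) : ℚ) : QZ) →
      χ (a + b) = ((((x + y : ℤ) : ℚ) / (2 ^ (n + 1) : ℕ) : ℚ) : QZ) := by
    intro a b x y hx hy
    rw [map_add, hx, hy, ← AddCircle.coe_add]
    congr 1
    push_cast
    ring
  have hcr : ∀ a b (x y : ℤ), χ a = (((x : ℚ) / (2 ^ (n + 1) : ℕ) : ℚ) : QZ) →
      χ b = (((y : ℚ) / (2 ^ (n + 1) : ℕ) : ℚ) : QZ) →
      crossEff q a b = ((((x * y : ℤ) : ℚ) / (2 ^ (n + 1) : ℕ) : ℚ) : QZ) := by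
    intro a b x y hx hy
    rw [crossEff, hq _ _ (hadd a b x y hx hy), hq _ _ hx, hq _ _ hy, ← AddCircle.coe_sub,
      ← AddCircle.coe_sub]
    congr 1
    push_cast
    field_simp
    ring
  refine ⟨q, ⟨⟨fun a b c => ?_, fun a b c => ?_⟩, fun a => ?_⟩, hq⟩
  · rw [hcr _ _ _ _ (hadd a b _ _ (hk a) (hk b)) (hk c), hcr _ _ _ _ (hk a) (hk c),
      hcr _ _ _ _ (hk b) (hk c), ← AddCircle.coe_add]
    congr 1
    push_cast
    ring
  · rw [hcr _ _ _ _ (hk a) (hadd b c _ _ (hk b) (hk c)), hcr _ _ _ _ (hk a) (hk c),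
      hcr _ _ _ _ (hk a) (hk b), ← AddCircle.coe_add]
    congr 1
    push_cast
    ring
  · have : χ (-a) = ((((- k a : ℤ) : ℚ) / (2 ^ (n + 1) : ℕ) : ℚ) : QZ) := by
      rw [map_neg, hk, ← AddCircle.coe_neg]
      congr 1
      push_cast
      ring
    rw [hq _ _ this, hq _ _ (hk a)]
    simp

/-- Separating quadratic form. -/
theorem exists_sep {A : Type*} [AddCommGroup A] (n : ℕ) (φ : tSub A (n + 1) →+ QZ)
    (hφ : ∀ x ∈ phiRel A (n + 1), φ x = 0) :
    ∃ q : A → QZ, IsHomogQuadraticMap q ∧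
      (∀ x : tSub A (n + 1), (2 ^ (n + 1) : ℕ) • q x = φ x) ∧
      ∀ m, m ≠ n → ∀ x : tSub A (m + 1), (2 ^ (m + 1) : ℕ) • q x = 0 := by
  have hmem : ∀ (k : ℕ) (a : A), a ∈ tSub A k ↔ (2 ^ k : ℕ) • a = 0 := fun k a => Iff.rfl
  let f : tSub A (n + 1) × A →+ A :=
    ((nsmulAddMonoidHom (2 ^ n)).comp (tSub A (n + 1)).subtype).coprod
      (nsmulAddMonoidHom (2 ^ (n + 1)))
  have hf : ∀ x : tSub A (n + 1) × A, f x = (2 ^ n : ℕ) • (x.1 : A) + (2 ^ (n + 1) : ℕ) • x.2 := by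
    intro x; simp [f]
  obtain ⟨χ, hχ⟩ := extend_char f (φ.comp (AddMonoidHom.fst _ _)) (by
    rintro ⟨⟨a, ha⟩, b⟩ h
    rw [hf] at h
    simp only at h
    apply hφ
    apply AddSubgroup.subset_closure
    refine ⟨-b, ?_, a + 2 • b, ?_, ?_⟩
    · rw [hmem] at ha ⊢
      have := congrArg (fun z => 2 • z) h
      simp only [smul_add, smul_zero, ← mul_smul] at this
      have e1 : 2 * 2 ^ n = 2 ^ (n + 1) := by ring
      have e2 : 2 * 2 ^ (n + 1) = 2 ^ (n + 1 + 1) := by ring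
      rw [e1, e2, ha, zero_add] at this
      rw [smul_neg, this, neg_zero]
    · rw [hmem]
      simp only [Nat.add_sub_cancel, smul_add, ← mul_smul]
      rw [← pow_succ, h]
    · simp)
  simp only [hf] at hχ
  have h1 : ∀ a : tSub A (n + 1), (2 ^ n : ℕ) • χ a = φ a := by
    intro a
    have := hχ (a, 0)
    simpa using this
  have h2 : ∀ a, (2 ^ (n + 1) : ℕ) • χ a = 0 := by
    intro a
    have := hχ (0, a)
    simpa using this
  obtain ⟨q, hq, hqs⟩ := exists_quad n χ h2
  refine ⟨q, hq, ?_, ?_⟩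
  · intro a
    obtain ⟨x, hx⟩ := qz_lift _ (by positivity) _ (h2 a)
    rw [← h1, hqs _ _ hx, hx, ← AddCircle.coe_nsmul, ← AddCircle.coe_nsmul]
    have e1 : (2 ^ (n + 1) : ℕ) • (((x ^ 2 : ℤ) : ℚ) / (2 ^ (n + 2) : ℕ)) =
        ((x ^ 2 : ℤ) : ℚ) / (2 : ℕ) := by
      simp only [nsmul_eq_mul]; push_cast; field_simp
      try ring
    have e2 : (2 ^ n : ℕ) • ((x : ℚ) / (2 ^ (n + 1) : ℕ)) = (x : ℚ) / (2 : ℕ) := by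
      simp only [nsmul_eq_mul]; push_cast; field_simp
      try ring
    rw [e1, e2, qz_eq_iff 2 (by norm_num)]
    have : x ^ 2 - x = x * (x - 1) := by ring
    rw [this]
    exact (Int.even_mul_pred_self x).two_dvd
  · rintro m hm ⟨a, ha⟩
    obtain ⟨x, hx⟩ := qz_lift _ (by positivity) _ (h2 a)
    simp only
    rw [hqs _ _ hx, ← AddCircle.coe_nsmul]
    rcases lt_or_gt_of_ne hm with h | h
    · obtain ⟨k, rfl⟩ := Nat.exists_eq_add_of_lt h
      have h3 : (2 ^ (m + 1) : ℕ) • χ a = 0 := by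
        rw [← map_nsmul, (hmem _ _).1 ha, map_zero]
      rw [hx, ← AddCircle.coe_nsmul] at h3
      have e1 : (2 ^ (m + 1) : ℕ) • ((x : ℚ) / (2 ^ (m + k + 1 + 1) : ℕ)) =
          (x : ℚ) / (2 ^ (k + 1) : ℕ) := by
        simp only [nsmul_eq_mul]; push_cast; field_simp
        try ring
      have e0 : (0 : QZ) = ((((0 : ℤ) : ℚ) / (2 ^ (k + 1) : ℕ) : ℚ) : QZ) := by simp
      rw [e1, e0, qz_eq_iff _ (by positivity)] at h3
      obtain ⟨r, hr⟩ := h3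
      have hr : x = (2 ^ (k + 1) : ℕ) * r := by linarith
      have e2 : (2 ^ (m + 1) : ℕ) • (((x ^ 2 : ℤ) : ℚ) / (2 ^ (m + k + 1 + 2) : ℕ)) =
          ((2 ^ k * r ^ 2 : ℤ) : ℚ) := by
        rw [hr]
        simp only [nsmul_eq_mul]; push_cast; field_simp
        try ring
      rw [e2, qz_int]
    · obtain ⟨k, rfl⟩ := Nat.exists_eq_add_of_lt h
      have e2 : (2 ^ (n + k + 1 + 1) : ℕ) • (((x ^ 2 : ℤ) : ℚ) / (2 ^ (n + 2) : ℕ)) =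
          ((2 ^ k * x ^ 2 : ℤ) : ℚ) := by
        simp only [nsmul_eq_mul]; push_cast; field_simp
        try ring
      rw [e2, qz_int]

end char

section final
universe u v w

theorem lift_char {A : Type u} {G : Type v} [AddCommGroup A] [AddCommGroup G] {γ : A → G}
    (hγuniv : ∀ (B : Type w) [AddCommGroup B] (f : A → B), IsHomogQuadraticMap f →
      ∃! h : G →+ B, ∀ a : A, f a = h (γ a)) (q : A → QZ) (hq : IsHomogQuadraticMap q) :
    ∃! h : G →+ QZ, ∀ a, q a = h (γ a) := by
  let U : ULift.{w} QZ ≃+ QZ := AddEquiv.ulift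
  have hq' : IsHomogQuadraticMap (fun a => U.symm (q a)) := by
    refine ⟨⟨fun a b c => ?_, fun a b c => ?_⟩, fun a => ?_⟩
    · have := congrArg U.symm (hq.1.1 a b c)
      simpa only [crossEff, map_add, map_sub] using this
    · have := congrArg U.symm (hq.1.2 a b c)
      simpa only [crossEff, map_add, map_sub] using this
    · simp only [hq.2]
  obtain ⟨h, h1, h2⟩ := hγuniv (ULift.{w} QZ) _ hq'
  refine ⟨U.toAddMonoidHom.comp h, fun a => ?_, fun g hg => ?_⟩
  · change q a = U (h (γ a))
    rw [← h1 a, U.apply_symm_apply]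
  · have := h2 (U.symm.toAddMonoidHom.comp g) (fun a => by
      change U.symm (q a) = U.symm (g (γ a))
      rw [hg a])
    rw [← this]
    ext x
    exact (U.apply_symm_apply _).symm

theorem gen_top {A : Type u} {G : Type v} [AddCommGroup A] [AddCommGroup G] {γ : A → G}
    (hγuniv : ∀ (B : Type w) [AddCommGroup B] (f : A → B), IsHomogQuadraticMap f →
      ∃! h : G →+ B, ∀ a : A, f a = h (γ a)) (x : G) :
    x ∈ Submodule.span ℤ (Set.range γ) := by
  by_contra hx
  let H := Submodule.span ℤ (Set.range γ)
  have hne : (H.mkQ x) ≠ 0 := by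
    rwa [Submodule.mkQ_apply, Ne, Submodule.Quotient.mk_eq_zero]
  obtain ⟨c, hc⟩ := CharacterModule.exists_character_apply_ne_zero_of_ne_zero hne
  let c' : G ⧸ H →+ QZ := c
  have h0 : IsHomogQuadraticMap (fun _ : A => (0 : QZ)) := by
    refine ⟨⟨fun a b c => ?_, fun a b c => ?_⟩, fun a => ?_⟩ <;> simp [crossEff]
  have := (lift_char hγuniv _ h0).unique (y₁ := c'.comp H.mkQ.toAddMonoidHom) (y₂ := 0) (by
    intro a
    change 0 = c' (H.mkQ (γ a))
    have : H.mkQ (γ a) = 0 := by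
      rw [Submodule.mkQ_apply, Submodule.Quotient.mk_eq_zero]
      exact Submodule.subset_span ⟨a, rfl⟩
    rw [this, map_zero]) (by intro a; rfl)
  exact hc (DFunLike.congr_fun this x)

def iotaN {A : Type u} {G : Type v} [AddCommGroup A] [AddCommGroup G] {γ : A → G}
    (hγ : IsHomogQuadraticMap γ) (n : ℕ) : tSub A (n + 1) →+ G :=
  AddMonoidHom.mk' (fun a => (2 ^ (n + 1) : ℕ) • γ a) (fun a b => by
    have ha : (2 ^ (n + 1) : ℕ) • (a : A) = 0 := a.2
    rw [AddSubgroup.coe_add, map_add' hγ, smul_add, smul_add, ← polar_nsmul_left, ha]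
    simp)

theorem iotaN_rel {A : Type u} {G : Type v} [AddCommGroup A] [AddCommGroup G] {γ : A → G}
    (hγ : IsHomogQuadraticMap γ) (n : ℕ) : phiRel A (n + 1) ≤ (iotaN hγ n).ker := by
  rw [phiRel, AddSubgroup.closure_le]
  rintro ⟨x, hx⟩ ⟨a, ha, b, hb, h⟩
  have ha' : (2 ^ (n + 1 + 1) : ℕ) • a = 0 := ha
  have hb' : (2 ^ n : ℕ) • b = 0 := hb
  have h : x = 2 • a + b := h
  have ga := two_smul_eq_zero hγ _ a ha'
  have gb := two_smul_eq_zero hγ _ b hb'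
  change (2 ^ (n + 1) : ℕ) • γ x = 0
  have hb2 : (2 ^ (n + 1) : ℕ) • b = 0 := by rw [pow_succ', mul_smul, hb', smul_zero]
  rw [h, map_add' hγ, smul_add, smul_add, map_nsmul' hγ, ← map_nsmul, hb2, map_zero, ← mul_smul]
  have e1 : 2 ^ (n + 1) * 2 ^ 2 = 2 * 2 ^ (n + 1 + 1) := by ring
  rw [e1, ga, pow_succ', gb]
  simp

end final

end PhiGam

/-- the sequence `0 → Φ(A) → Γ(A) → A ⊗ A → Λ²(A) → 0` is exact, where
`Φ(A) = ⊕_{n ≥ 1} Φ_n(A)` maps in by `a ↦ 2ⁿ γ(a)` on the `n`-th summand, the map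
`τ : Γ(A) → A ⊗ A` sends `γ(a)` to `a ⊗ a`, and `A ⊗ A → Λ²(A)` is the projection. -/
theorem Phi_Gamma_tensor_exterior_exact {A G : Type*} [AddCommGroup A] [AddCommGroup G]
    (γ : A → G) (hγ : IsHomogQuadraticMap γ)
    (hγuniv : ∀ (B : Type*) [AddCommGroup B] (f : A → B), IsHomogQuadraticMap f →
      ∃! h : G →+ B, ∀ a : A, f a = h (γ a))
    (τ : G →+ (A ⊗[ℤ] A)) (hτ : ∀ a : A, τ (γ a) = a ⊗ₜ[ℤ] a) :
    ∃ ι : (⨁ n : ℕ, PhiN A (n + 1)) →+ G,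
      (∀ (n : ℕ) (a : A) (ha : a ∈ tSub A (n + 1)),
        ι (DirectSum.of (fun m => PhiN A (m + 1)) n (QuotientAddGroup.mk ⟨a, ha⟩)) =
          (2 ^ (n + 1) : ℕ) • γ a) ∧
      Function.Injective ι ∧
      AddMonoidHom.range ι = AddMonoidHom.ker τ ∧
      AddMonoidHom.range τ = AddMonoidHom.ker (lamProj A) ∧
      Function.Surjective (lamProj A) := by

  have hgen := PhiGam.gen_top hγuniv
  have hlift := PhiGam.lift_char hγuniv
  let ψ : ∀ n : ℕ, PhiN A (n + 1) →+ G := fun n => QuotientAddGroup.lift (phiRel A (n + 1))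
      (PhiGam.iotaN hγ n) (PhiGam.iotaN_rel hγ n)
  let ι : (⨁ n : ℕ, PhiN A (n + 1)) →+ G := DirectSum.toAddMonoid ψ
  have hι : ∀ (n : ℕ) (a : A) (ha : a ∈ tSub A (n + 1)),
        ι (DirectSum.of (fun m => PhiN A (m + 1)) n (QuotientAddGroup.mk ⟨a, ha⟩)) =
          (2 ^ (n + 1) : ℕ) • γ a := by
    intro n a ha
    exact (DirectSum.toAddMonoid_of ψ n _).trans rfl
  refine ⟨ι, hι, ?_, ?_, ?_, ?_⟩
  · rw [injective_iff_map_eq_zero]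
    intro y hy
    by_contra hne
    have : ∃ n, y n ≠ 0 := by
      by_contra hcon
      push Not at hcon
      exact hne (DFinsupp.ext hcon)
    obtain ⟨n, hn⟩ := this
    obtain ⟨c, hc⟩ := CharacterModule.exists_character_apply_ne_zero_of_ne_zero hn
    let c' : PhiN A (n + 1) →+ PhiGam.QZ := c
    let φ : tSub A (n + 1) →+ PhiGam.QZ :=
      c'.comp (QuotientAddGroup.mk' (phiRel A (n + 1)) : tSub A (n + 1) →+ PhiN A (n + 1))
    obtain ⟨q, hq, hq1, hq2⟩ := PhiGam.exists_sep n φ (by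
      intro x hx
      have : (QuotientAddGroup.mk' (phiRel A (n + 1)) x) = 0 :=
        (QuotientAddGroup.eq_zero_iff x).2 hx
      change c' (QuotientAddGroup.mk' (phiRel A (n + 1)) x) = 0
      rw [this]
      exact map_zero c')
    obtain ⟨h, hh, -⟩ := hlift q hq
    have key : h.comp ι = c'.comp (DFinsupp.evalAddMonoidHom n :
        (⨁ n : ℕ, PhiN A (n + 1)) →+ PhiN A (n + 1)) := by
      refine DirectSum.addHom_ext fun m z => ?_
      obtain ⟨⟨a, ha⟩, rfl⟩ := QuotientAddGroup.mk_surjective z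
      rw [AddMonoidHom.comp_apply, hι, map_nsmul, ← hh]
      by_cases hmn : m = n
      · subst hmn
        refine (hq1 ⟨a, ha⟩).trans ?_
        exact congrArg c' (DirectSum.of_eq_same (β := fun m => PhiN A (m + 1)) m _).symm
      · refine (hq2 m hmn ⟨a, ha⟩).trans ?_
        rw [← map_zero c']
        exact congrArg c' (DirectSum.of_eq_of_ne (β := fun m => PhiN A (m + 1)) _ _ _
          (Ne.symm hmn)).symm
    have := DFunLike.congr_fun key y
    rw [AddMonoidHom.comp_apply, hy, map_zero] at this
    exact hc this.symm
  · apply le_antisymm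
    · rintro _ ⟨y, rfl⟩
      rw [AddMonoidHom.mem_ker]
      have key : τ.comp ι = 0 := by
        refine DirectSum.addHom_ext fun m z => ?_
        obtain ⟨⟨a, ha⟩, rfl⟩ := QuotientAddGroup.mk_surjective z
        rw [AddMonoidHom.comp_apply, hι, map_nsmul, hτ, TensorProduct.smul_tmul']
        have : (2 ^ (m + 1) : ℕ) • a = 0 := ha
        rw [this]
        simp
      exact DFunLike.congr_fun key y
    · intro x hx
      rw [AddMonoidHom.mem_ker] at hx
      obtain ⟨c, rfl⟩ := Finsupp.mem_span_range_iff_exists_finsupp.1 (hgen x)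
      rw [Finsupp.sum, ← Finset.sum_coe_sort] at hx ⊢
      refine PhiGam.core hγ ι.range ?_ (fun k : c.support => c k) (fun k => (k : A)) ?_
      · intro n a ha
        exact ⟨_, hι n a ha⟩
      · simpa only [map_sum, map_zsmul, hτ] using hx
  · have hk : ∀ t : A ⊗[ℤ] A, t ∈ (lamProj A).ker ↔ t ∈ altRel A := fun t => by
      rw [AddMonoidHom.mem_ker]
      exact Submodule.Quotient.mk_eq_zero _
    ext t
    rw [hk]
    constructor
    · rintro ⟨x, rfl⟩
      induction hgen x using Submodule.span_induction with
      | mem x hx =>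
        obtain ⟨a, rfl⟩ := hx
        rw [hτ]
        exact Submodule.subset_span ⟨a, rfl⟩
      | zero => rw [map_zero]; exact zero_mem _
      | add x y _ _ hx hy => rw [map_add]; exact add_mem hx hy
      | smul r x _ hx => rw [map_zsmul]; exact Submodule.smul_mem _ _ hx
    · intro ht
      have : altRel A ≤ LinearMap.range τ.toIntLinearMap := by
        rw [altRel, Submodule.span_le]
        rintro _ ⟨a, rfl⟩
        exact ⟨γ a, hτ a⟩
      exact this ht
  · exact Submodule.mkQ_surjective (altRel A)
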